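/- arXiv:2105.03683 — 10 statements merged into one kernel-verified Lean document; each statement's English description precedes it below -/
import Mathlib

section
/- Let I be a nonempty finite set of agents, T ≥ 1, and X : I × {1,…,T} → {x,y} choice data. If there exist real thresholds ū : I → ℝ and real numbers p : {1,…,T} → ℝ (common beliefs, obtained by any updating procedure whatsoever) such that for every agent i and period t, p_t > ū_i whenever X(i,t) = x and p_t < ū_i whenever X(i,t) = y, then X has no cycles. -/
/-!
Choices are encoded by `Bool`: `true` stands for alternative `x`, `false` for `y`.
Periods are the natural numbers `1, …, T`.
-/

/-- `X` has a cycle: there are distinct periods `t₁ ≠ t₂` in `{1,…,T}` and agents `i, j`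
with `X i t₁ = X j t₂ = x` and `X i t₂ = X j t₁ = y`. -/
def HasCycle {I : Type*} (T : ℕ) (X : I → ℕ → Bool) : Prop :=
  ∃ t₁ ∈ Finset.Icc 1 T, ∃ t₂ ∈ Finset.Icc 1 T, t₁ ≠ t₂ ∧ ∃ i j : I,
    X i t₁ = true ∧ X j t₂ = true ∧ X i t₂ = false ∧ X j t₁ = false

/-- **Necessity (no Bayesian updating needed).** If there are real thresholds `u : I → ℝ`
and common beliefs `p : {1,…,T} → ℝ` (obtained by any updating procedure whatsoever) such
that for every agent `i` and period `t`, `p t > u i` whenever `X i t = x` and `p t < u i`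
whenever `X i t = y`, then `X` has no cycles. -/
theorem necessity_no_cycles {I : Type*} [Fintype I] [Nonempty I]
    (T : ℕ) (hT : 1 ≤ T) (X : I → ℕ → Bool)
    (u : I → ℝ) (p : ℕ → ℝ)
    (hopt : ∀ i, ∀ t ∈ Finset.Icc 1 T,
      (X i t = true → u i < p t) ∧ (X i t = false → p t < u i)) :
    ¬ HasCycle T X := by
  rintro ⟨t₁, ht₁, t₂, ht₂, -, i, j, hi₁, hj₂, hi₂, hj₁⟩
  exact lt_irrefl (u i) <| calc
    u i < p t₁ := (hopt i t₁ ht₁).1 hi₁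
    _ < u j := (hopt j t₁ ht₁).2 hj₁
    _ < p t₂ := (hopt j t₂ ht₂).1 hj₂
    _ < u i := (hopt i t₂ ht₂).2 hi₂
end

section
/- Let I be a nonempty finite set of agents, T ≥ 1, and X : I × {1,…,T} → {x,y} choice data. If X is rationalizable, then X is rationalizable with a time-invariant state, i.e., with transition probabilities satisfying γ_t(ω_x|ω_x) = 1 and γ_t(ω_x|ω_y) = 0 for every period t. -/
/-!
Choices are encoded by `Bool`: `true` stands for alternative `x`, `false` for `y`.
Periods are the natural numbers `1, …, T`; `p 0` plays the role of the prior `p₀`.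
-/

/-- `X` is rationalizable (possibly with a time-varying state): there are thresholds
`u : I → [0,1]`, beliefs `p : {0,…,T} → [0,1]` (with `p 0` the prior), transition
probabilities `γxx t = γ_t(ω_x|ω_x)`, `γxy t = γ_t(ω_x|ω_y)` in `[0,1]`, and
realized-signal likelihoods `a t, b t ∈ [0,1]` not both zero, such that each `p t` is
obtained from `p (t-1)` by Bayes' rule (with strictly positive denominator), and for
every agent `i` and period `t ∈ {1,…,T}`: `p t > u i` if `X i t = x`, and `p t < u i`
if `X i t = y`. -/
def Rationalizable {I : Type*} (T : ℕ) (X : I → ℕ → Bool) : Prop :=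
  ∃ (u : I → ℝ) (p : ℕ → ℝ) (γxx γxy a b : ℕ → ℝ),
    (∀ i, u i ∈ Set.Icc (0:ℝ) 1) ∧
    (∀ t ≤ T, p t ∈ Set.Icc (0:ℝ) 1) ∧
    (∀ t ∈ Finset.Icc 1 T,
      γxx t ∈ Set.Icc (0:ℝ) 1 ∧ γxy t ∈ Set.Icc (0:ℝ) 1 ∧
      a t ∈ Set.Icc (0:ℝ) 1 ∧ b t ∈ Set.Icc (0:ℝ) 1 ∧
      ¬(a t = 0 ∧ b t = 0) ∧
      0 < (p (t-1) * γxx t + (1 - p (t-1)) * γxy t) * a t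
          + (1 - (p (t-1) * γxx t + (1 - p (t-1)) * γxy t)) * b t ∧
      p t = (p (t-1) * γxx t + (1 - p (t-1)) * γxy t) * a t /
          ((p (t-1) * γxx t + (1 - p (t-1)) * γxy t) * a t
            + (1 - (p (t-1) * γxx t + (1 - p (t-1)) * γxy t)) * b t)) ∧
    (∀ i, ∀ t ∈ Finset.Icc 1 T,
      (X i t = true → u i < p t) ∧ (X i t = false → p t < u i))

/-- `X` is rationalizable with a time-invariant state: as in `Rationalizable`, but in
addition the transition probabilities satisfy `γ_t(ω_x|ω_x) = 1` and `γ_t(ω_x|ω_y) = 0`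
for every period `t`. -/
def RationalizableTimeInvariant {I : Type*} (T : ℕ) (X : I → ℕ → Bool) : Prop :=
  ∃ (u : I → ℝ) (p : ℕ → ℝ) (γxx γxy a b : ℕ → ℝ),
    (∀ i, u i ∈ Set.Icc (0:ℝ) 1) ∧
    (∀ t ≤ T, p t ∈ Set.Icc (0:ℝ) 1) ∧
    (∀ t ∈ Finset.Icc 1 T, γxx t = 1 ∧ γxy t = 0) ∧
    (∀ t ∈ Finset.Icc 1 T,
      γxx t ∈ Set.Icc (0:ℝ) 1 ∧ γxy t ∈ Set.Icc (0:ℝ) 1 ∧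
      a t ∈ Set.Icc (0:ℝ) 1 ∧ b t ∈ Set.Icc (0:ℝ) 1 ∧
      ¬(a t = 0 ∧ b t = 0) ∧
      0 < (p (t-1) * γxx t + (1 - p (t-1)) * γxy t) * a t
          + (1 - (p (t-1) * γxx t + (1 - p (t-1)) * γxy t)) * b t ∧
      p t = (p (t-1) * γxx t + (1 - p (t-1)) * γxy t) * a t /
          ((p (t-1) * γxx t + (1 - p (t-1)) * γxy t) * a t
            + (1 - (p (t-1) * γxx t + (1 - p (t-1)) * γxy t)) * b t)) ∧
    (∀ i, ∀ t ∈ Finset.Icc 1 T,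
      (X i t = true → u i < p t) ∧ (X i t = false → p t < u i))

/-- Any belief `r ∈ (0,1)` is the Bayesian posterior of any prior `q ∈ (0,1)` for the
signal likelihoods `r * (1 - q)` and `q * (1 - r)`. -/
theorem bayes_posterior_of_mem_Ioo {q r : ℝ} (hq : q ∈ Set.Ioo (0:ℝ) 1)
    (hr : r ∈ Set.Ioo (0:ℝ) 1) :
    r * (1 - q) ∈ Set.Ioo (0:ℝ) 1 ∧ q * (1 - r) ∈ Set.Ioo (0:ℝ) 1 ∧
      0 < q * (r * (1 - q)) + (1 - q) * (q * (1 - r)) ∧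
      r = q * (r * (1 - q)) / (q * (r * (1 - q)) + (1 - q) * (q * (1 - r))) := by
  obtain ⟨hq0, hq1⟩ := hq
  obtain ⟨hr0, hr1⟩ := hr
  have hq' : 0 < 1 - q := sub_pos.2 hq1
  have hr' : 0 < 1 - r := sub_pos.2 hr1
  refine ⟨⟨by positivity, by nlinarith⟩, ⟨by positivity, by nlinarith⟩, by positivity, ?_⟩
  rw [eq_div_iff (by positivity)]
  ring

/-- If choice data is rationalizable, then it is rationalizable with a time-invariant
state. -/
theorem rationalizable_time_invariant {I : Type*} [Fintype I] [Nonempty I]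
    (T : ℕ) (hT : 1 ≤ T) (X : I → ℕ → Bool)
    (h : Rationalizable T X) : RationalizableTimeInvariant T X := by
  obtain ⟨u, p, -, -, -, -, hu, hp, -, hX⟩ := h
  have hp' : ∀ t ≤ T, (p t + 1) / 3 ∈ Set.Ioo (0:ℝ) 1 := fun t ht => by
    obtain ⟨h0, h1⟩ := hp t ht
    constructor <;> linarith
  refine ⟨fun i => (u i + 1) / 3, fun t => (p t + 1) / 3, fun _ => 1, fun _ => 0,
    fun t => (p t + 1) / 3 * (1 - (p (t - 1) + 1) / 3),
    fun t => (p (t - 1) + 1) / 3 * (1 - (p t + 1) / 3),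
    fun i => ?_, fun t ht => Set.Ioo_subset_Icc_self (hp' t ht), fun _ _ => ⟨rfl, rfl⟩,
    fun t ht => ?_, fun i t ht => ?_⟩
  · obtain ⟨h0, h1⟩ := hu i
    constructor <;> linarith
  · have htT : t ≤ T := (Finset.mem_Icc.1 ht).2
    obtain ⟨ha, hb, hpos, heq⟩ :=
      bayes_posterior_of_mem_Ioo (hp' (t - 1) ((Nat.sub_le t 1).trans htT)) (hp' t htT)
    simp only [mul_one, mul_zero, add_zero]
    exact ⟨by simp, by simp, Set.Ioo_subset_Icc_self ha, Set.Ioo_subset_Icc_self hb,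
      fun h => ha.1.ne' h.1, hpos, heq⟩
  · obtain ⟨hx, hy⟩ := hX i t ht
    exact ⟨fun h => by linarith [hx h], fun h => by linarith [hy h]⟩
end

section
/- Let I be a nonempty finite set of agents, T ≥ 1, and X : I × {1,…,T} → {x,y} choice data. Then X is rationalizable with general preferences if and only if there exists a profile of permutations κ = (κ_i)_{i∈I}, where each κ_i is a bijection of {x,y}, such that the permuted choice data X^κ defined by X^κ(i,t) = κ_i(X(i,t)) has no cycles. -/
/-- `X` is rationalizable with general preferences: there are thresholds `u : I → ℝ`,
signs `η : I → {−1,1}`, beliefs `p : {0,…,T} → [0,1]` (with `p 0` the prior),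
transition probabilities `γxx t = γ_t(ω_x|ω_x)`, `γxy t = γ_t(ω_x|ω_y)` in `[0,1]`, and
realized-signal likelihoods `a t, b t ∈ [0,1]` not both zero, such that each `p t` is
obtained from `p (t-1)` by Bayes' rule (with strictly positive denominator), and for
every agent `i` and period `t ∈ {1,…,T}`: `η i * p t > u i` if `X i t = x`, and
`η i * p t < u i` if `X i t = y`. -/
def RationalizableGeneral {I : Type*} (T : ℕ) (X : I → ℕ → Bool) : Prop :=
  ∃ (u : I → ℝ) (η : I → ℝ) (p : ℕ → ℝ) (γxx γxy a b : ℕ → ℝ),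
    (∀ i, η i = 1 ∨ η i = -1) ∧
    (∀ t ≤ T, p t ∈ Set.Icc (0:ℝ) 1) ∧
    (∀ t ∈ Finset.Icc 1 T,
      γxx t ∈ Set.Icc (0:ℝ) 1 ∧ γxy t ∈ Set.Icc (0:ℝ) 1 ∧
      a t ∈ Set.Icc (0:ℝ) 1 ∧ b t ∈ Set.Icc (0:ℝ) 1 ∧
      ¬(a t = 0 ∧ b t = 0) ∧
      0 < (p (t-1) * γxx t + (1 - p (t-1)) * γxy t) * a t
          + (1 - (p (t-1) * γxx t + (1 - p (t-1)) * γxy t)) * b t ∧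
      p t = (p (t-1) * γxx t + (1 - p (t-1)) * γxy t) * a t /
          ((p (t-1) * γxx t + (1 - p (t-1)) * γxy t) * a t
            + (1 - (p (t-1) * γxx t + (1 - p (t-1)) * γxy t)) * b t)) ∧
    (∀ i, ∀ t ∈ Finset.Icc 1 T,
      (X i t = true → u i < η i * p t) ∧ (X i t = false → η i * p t < u i))

/-- Data without cycles are ordered by threshold rules in a common index in `[0,1]`. -/
theorem exists_threshold_of_not_hasCycle {I : Type*} [Fintype I] [Nonempty I]
    {T : ℕ} {Y : I → ℕ → Bool} (hY : ¬ HasCycle T Y) :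
    ∃ (v : I → ℝ) (p : ℕ → ℝ), (∀ t, p t ∈ Set.Icc (0:ℝ) 1) ∧
      ∀ i, ∀ t ∈ Finset.Icc 1 T,
        (Y i t = true → v i < p t) ∧ (Y i t = false → p t < v i) := by
  classical
  let S : ℕ → Finset I := fun t => Finset.univ.filter fun i => Y i t = true
  let m : I → ℕ := fun i =>
    ((Finset.Icc 1 T).filter fun t => Y i t = false).sup fun t => (S t).card
  have hN : (0:ℝ) < Fintype.card I := by exact_mod_cast Fintype.card_pos
  refine ⟨fun i => (m i + 1 / 2) / Fintype.card I, fun t => (S t).card / Fintype.card I,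
    fun t => ⟨by positivity, ?_⟩, fun i t ht => ⟨fun h => ?_, fun h => ?_⟩⟩
  · rw [div_le_one hN]
    exact_mod_cast Finset.card_le_univ (S t)
  · have hi : i ∈ S t := by simp [S, h]
    have hm : m i < (S t).card := by
      refine (Finset.sup_lt_iff (Finset.card_pos.2 ⟨i, hi⟩)).2 fun s hs => ?_
      obtain ⟨hs, his⟩ := Finset.mem_filter.1 hs
      refine Finset.card_lt_card ((Finset.ssubset_iff_of_subset fun j hj => ?_).2
        ⟨i, hi, by simp [S, his]⟩)
      by_contra hjt
      simp only [S, Finset.mem_filter, Finset.mem_univ, true_and, Bool.not_eq_true] at hj hjt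
      refine hY ⟨t, ht, s, hs, ?_, i, j, h, hj, his, hjt⟩
      rintro rfl
      simp [h] at his
    have hm' : (m i : ℝ) + 1 ≤ (S t).card := by exact_mod_cast hm
    exact div_lt_div_of_pos_right (by linarith) hN
  · have hm : (S t).card ≤ m i :=
      Finset.le_sup (f := fun t => (S t).card) (Finset.mem_filter.2 ⟨ht, h⟩)
    have hm' : ((S t).card : ℝ) ≤ m i := by exact_mod_cast hm
    exact div_lt_div_of_pos_right (by linarith) hN

/-- Threshold rules in a common index have no cycles. -/
theorem not_hasCycle_of_threshold {I : Type*} {T : ℕ} {Y : I → ℕ → Bool}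
    {v : I → ℝ} {p : ℕ → ℝ}
    (h : ∀ i, ∀ t ∈ Finset.Icc 1 T,
      (Y i t = true → v i < p t) ∧ (Y i t = false → p t < v i)) :
    ¬ HasCycle T Y := by
  rintro ⟨t, ht, s, hs, -, i, j, hit, hjs, his, hjt⟩
  have h₁ := (h i t ht).1 hit
  have h₂ := (h i s hs).2 his
  have h₃ := (h j s hs).1 hjs
  have h₄ := (h j t ht).2 hjt
  linarith

theorem Equiv.Perm.bool_apply_false (κ : Equiv.Perm Bool) : κ false = !κ true :=
  Bool.eq_not.2 fun h => Bool.false_ne_true (κ.injective h)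

/-- **Corollary 1 (general preferences).** Choice data `X` is rationalizable with general
preferences if and only if there is a profile `κ` of permutations of `{x,y}`, one for each
agent, such that the permuted choice data `X^κ` has no cycles. -/
theorem general_preferences_characterization {I : Type*} [Fintype I] [Nonempty I]
    (T : ℕ) (hT : 1 ≤ T) (X : I → ℕ → Bool) :
    RationalizableGeneral T X ↔
      ∃ κ : I → Equiv.Perm Bool, ¬ HasCycle T (fun i t => κ i (X i t)) := by
  constructor
  · rintro ⟨u, η, p, -, -, -, -, hη, -, -, h⟩
    refine ⟨fun i => if η i = 1 then Equiv.refl Bool else Equiv.boolNot,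
      not_hasCycle_of_threshold (v := fun i => η i * u i) (p := p) fun i t ht => ?_⟩
    obtain ⟨hx, hy⟩ := h i t ht
    rcases hη i with hi | hi
    · simpa [hi] using And.intro hx hy
    · have hne : η i ≠ 1 := by rw [hi]; norm_num
      rw [hi] at hx hy
      simp only [if_neg hne, Equiv.boolNot_apply, Bool.not_eq_true', Bool.not_eq_false']
      rw [hi]
      exact ⟨fun hX => by linarith [hy hX], fun hX => by linarith [hx hX]⟩
  · rintro ⟨κ, hκ⟩
    obtain ⟨v, p, hp, h⟩ := exists_threshold_of_not_hasCycle hκ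
    let η : I → ℝ := fun i => if κ i true = true then 1 else -1
    refine ⟨fun i => η i * v i, η, p, p, p, fun _ => 1, fun _ => 1,
      fun i => ite_eq_or_eq _ _ _, fun t _ => hp t, fun t _ => ?_, fun i t ht => ?_⟩
    · have hq : p (t - 1) * p t + (1 - p (t - 1)) * p t = p t := by ring
      rw [hq]
      exact ⟨hp t, hp t, by norm_num, by norm_num, by norm_num, by norm_num, by norm_num⟩
    · obtain ⟨hx, hy⟩ := h i t ht
      have hf := Equiv.Perm.bool_apply_false (κ i)
      cases hX : X i t <;> cases hκi : κ i true <;> simp_all [η]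
end

section
/- Let I be a nonempty finite set of agents, T ≥ 1, N ≥ 1, and let X : I × {1,…,T} → {y₁,…,y_N} be choice data over N ordered alternatives. Then X is rationalizable with multiple alternatives if and only if X has no cycles (in the multiple-alternative sense). -/
/-!
Alternatives `y₁, …, y_N` are encoded by their indices `1, …, N : ℕ`, so choice data is a
map `X : I → ℕ → ℕ` with `X i t ∈ {1,…,N}` for periods `t ∈ {1,…,T}`; `p 0` is the prior.
-/

/-- `X` has a cycle in the multiple-alternative sense: there are distinct periods
`t₁ ≠ t₂` in `{1,…,T}` and agents `i, j` with `X i t₁ > X i t₂` and `X j t₁ < X j t₂`. -/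
def HasCycleMulti {I : Type*} (T : ℕ) (X : I → ℕ → ℕ) : Prop :=
  ∃ t₁ ∈ Finset.Icc 1 T, ∃ t₂ ∈ Finset.Icc 1 T, t₁ ≠ t₂ ∧ ∃ i j : I,
    X i t₂ < X i t₁ ∧ X j t₁ < X j t₂

/-- `X` is rationalizable with multiple alternatives: there are, for each agent `i`,
cutoffs `0 = u i 1 < u i 2 < ⋯ < u i (N+1) = 1`, beliefs `p : {0,…,T} → [0,1]`
(with `p 0` the prior), transition probabilities and realized-signal likelihoods in
`[0,1]` (the likelihoods not both zero) with each `p t` obtained from `p (t-1)` by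
Bayes' rule (strictly positive denominator), such that for every agent `i` and period
`t ∈ {1,…,T}`: `u i (X i t) < p t < u i (X i t + 1)`. -/
def RationalizableMulti {I : Type*} (T N : ℕ) (X : I → ℕ → ℕ) : Prop :=
  ∃ (u : I → ℕ → ℝ) (p : ℕ → ℝ) (γxx γxy a b : ℕ → ℝ),
    (∀ i, u i 1 = 0 ∧ u i (N+1) = 1 ∧ ∀ n ∈ Finset.Icc 1 N, u i n < u i (n+1)) ∧
    (∀ t ≤ T, p t ∈ Set.Icc (0:ℝ) 1) ∧
    (∀ t ∈ Finset.Icc 1 T,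
      γxx t ∈ Set.Icc (0:ℝ) 1 ∧ γxy t ∈ Set.Icc (0:ℝ) 1 ∧
      a t ∈ Set.Icc (0:ℝ) 1 ∧ b t ∈ Set.Icc (0:ℝ) 1 ∧
      ¬(a t = 0 ∧ b t = 0) ∧
      0 < (p (t-1) * γxx t + (1 - p (t-1)) * γxy t) * a t
          + (1 - (p (t-1) * γxx t + (1 - p (t-1)) * γxy t)) * b t ∧
      p t = (p (t-1) * γxx t + (1 - p (t-1)) * γxy t) * a t /
          ((p (t-1) * γxx t + (1 - p (t-1)) * γxy t) * a t
            + (1 - (p (t-1) * γxx t + (1 - p (t-1)) * γxy t)) * b t)) ∧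
    (∀ i, ∀ t ∈ Finset.Icc 1 T,
      u i (X i t) < p t ∧ p t < u i (X i t + 1))

/-- Without cycles, the choices of all agents are monotone in the sum of the choices. -/
theorem le_of_sum_le_of_not_hasCycleMulti {I : Type*} [Fintype I] {T : ℕ} {X : I → ℕ → ℕ}
    (h : ¬ HasCycleMulti T X) {t t' : ℕ} (ht : t ∈ Finset.Icc 1 T) (ht' : t' ∈ Finset.Icc 1 T)
    (hs : ∑ i, X i t ≤ ∑ i, X i t') (i : I) : X i t ≤ X i t' := by
  by_contra! hi
  have hne : t ≠ t' := by rintro rfl; exact lt_irrefl _ hi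
  have hle : ∀ j, X j t' ≤ X j t := by
    intro j
    by_contra! hj
    exact h ⟨t, ht, t', ht', hne, i, j, hi, hj⟩
  exact absurd hs (not_le.mpr (Finset.sum_lt_sum (fun j _ => hle j) ⟨i, Finset.mem_univ i, hi⟩))

theorem not_hasCycleMulti_of_rationalizableMulti {I : Type*} {T N : ℕ} {X : I → ℕ → ℕ}
    (hX : ∀ i, ∀ t ∈ Finset.Icc 1 T, X i t ∈ Finset.Icc 1 N)
    (h : RationalizableMulti T N X) : ¬ HasCycleMulti T X := by
  obtain ⟨u, p, -, -, -, -, hu, -, -, hp⟩ := h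
  have mono : ∀ i, MonotoneOn (u i) (Set.Icc 1 (N + 1)) := by
    intro i
    refine monotoneOn_of_le_add_one Set.ordConnected_Icc fun n _ hn hn' => ?_
    exact ((hu i).2.2 n (Finset.mem_Icc.mpr ⟨hn.1, by have := hn'.2; omega⟩)).le
  have key : ∀ i, ∀ t ∈ Finset.Icc 1 T, ∀ t' ∈ Finset.Icc 1 T, X i t < X i t' → p t < p t' := by
    intro i t ht t' ht' hlt
    have h₁ := Finset.mem_Icc.mp (hX i t ht)
    have h₂ := Finset.mem_Icc.mp (hX i t' ht')
    calc p t < u i (X i t + 1) := (hp i t ht).2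
      _ ≤ u i (X i t') := mono i ⟨by omega, by omega⟩ ⟨by omega, by omega⟩ hlt
      _ < p t' := (hp i t' ht').1
  rintro ⟨t₁, h₁, t₂, h₂, -, i, j, hi, hj⟩
  exact lt_asymm (key i t₂ h₂ t₁ h₁ hi) (key j t₁ h₁ t₂ h₂ hj)

/-- Any beliefs in the unit interval satisfy Bayes' rule with uninformative signals and
transitions that do not depend on the current state. -/
theorem rationalizableMulti_of_cutoffs {I : Type*} {T N : ℕ} {X : I → ℕ → ℕ}
    (u : I → ℕ → ℝ) (p : ℕ → ℝ)
    (hu : ∀ i, u i 1 = 0 ∧ u i (N + 1) = 1 ∧ ∀ n ∈ Finset.Icc 1 N, u i n < u i (n + 1))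
    (hp : ∀ t ≤ T, p t ∈ Set.Icc (0 : ℝ) 1)
    (hup : ∀ i, ∀ t ∈ Finset.Icc 1 T, u i (X i t) < p t ∧ p t < u i (X i t + 1)) :
    RationalizableMulti T N X := by
  refine ⟨u, p, p, p, fun _ => 1, fun _ => 1, hu, hp, fun t ht => ?_, hup⟩
  have hpt := hp t (Finset.mem_Icc.mp ht).2
  have hq : p (t - 1) * p t + (1 - p (t - 1)) * p t = p t := by ring
  refine ⟨hpt, hpt, by simp, by simp, by simp, ?_, ?_⟩ <;> simp [hq]

theorem rationalizableMulti_of_not_hasCycleMulti {I : Type*} [Fintype I] [Nonempty I]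
    {T N : ℕ} (hN : 1 ≤ N) {X : I → ℕ → ℕ}
    (hX : ∀ i, ∀ t ∈ Finset.Icc 1 T, X i t ∈ Finset.Icc 1 N)
    (h : ¬ HasCycleMulti T X) : RationalizableMulti T N X := by
  let s : ℕ → ℕ := fun t => ∑ i, X i t
  let S : ℕ := (Finset.Icc 1 T).sup s
  let M : I → ℕ → ℕ := fun i n => {t ∈ Finset.Icc 1 T | X i t < n}.sup s
  have hN₀ : (0 : ℝ) < N := by exact_mod_cast hN
  have hS : (0 : ℝ) < S + 1 := by positivity
  have hM₁ : ∀ i, M i 1 = 0 := by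
    intro i
    have hempty : {t ∈ Finset.Icc 1 T | X i t < 1} = ∅ := by
      refine Finset.filter_eq_empty_iff.mpr fun t ht => ?_
      exact not_lt.mpr (Finset.mem_Icc.mp (hX i t ht)).1
    simp only [M, hempty, Finset.sup_empty, bot_eq_zero]
  have hM_last : ∀ i, M i (N + 1) = S := by
    intro i
    have hall : {t ∈ Finset.Icc 1 T | X i t < N + 1} = Finset.Icc 1 T :=
      Finset.filter_true_of_mem fun t ht => Nat.lt_succ_of_le (Finset.mem_Icc.mp (hX i t ht)).2
    simp only [M, S, hall]
  have hM_mono : ∀ i n, M i n ≤ M i (n + 1) := fun i n =>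
    Finset.sup_mono (Finset.monotone_filter_right _ fun _ _ ht => Nat.lt_succ_of_lt ht)
  have hs_pos : ∀ t ∈ Finset.Icc 1 T, 0 < s t := fun t ht =>
    Finset.sum_pos (fun i _ => (Finset.mem_Icc.mp (hX i t ht)).1) Finset.univ_nonempty
  have hM_lt : ∀ i, ∀ t ∈ Finset.Icc 1 T, M i (X i t) < s t := by
    intro i t ht
    refine (Finset.sup_lt_iff (hs_pos t ht)).mpr fun t' ht' => ?_
    obtain ⟨ht', hlt⟩ := Finset.mem_filter.mp ht'
    by_contra! hle
    exact absurd (le_of_sum_le_of_not_hasCycleMulti h ht ht' hle i) (not_le.mpr hlt)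
  have hle_M : ∀ i, ∀ t ∈ Finset.Icc 1 T, s t ≤ M i (X i t + 1) := fun i t ht =>
    Finset.le_sup (f := s) (Finset.mem_filter.mpr ⟨ht, Nat.lt_succ_self _⟩)
  refine rationalizableMulti_of_cutoffs
    (fun i n => (M i n + ((n : ℝ) - 1) / N) / (S + 1))
    (fun t => (min (s t) S : ℕ) / ((S : ℝ) + 1)) (fun i => ⟨?_, ?_, fun n _ => ?_⟩)
    (fun t _ => ⟨by positivity, ?_⟩) (fun i t ht => ?_)
  · simp [hM₁]
  · rw [hM_last]
    push_cast
    field_simp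
    ring
  · have hmono : (M i n : ℝ) ≤ M i (n + 1) := by exact_mod_cast hM_mono i n
    push_cast
    gcongr ?_ / _
    refine add_lt_add_of_le_of_lt hmono ?_
    gcongr
    linarith
  · rw [div_le_one hS]
    have : ((min (s t) S : ℕ) : ℝ) ≤ S := by exact_mod_cast min_le_right _ _
    linarith
  · have hmin : min (s t) S = s t := min_eq_left (Finset.le_sup (f := s) ht)
    have hXt := Finset.mem_Icc.mp (hX i t ht)
    have hX₁ : (1 : ℝ) ≤ X i t := by exact_mod_cast hXt.1
    have hXN : (X i t : ℝ) ≤ N := by exact_mod_cast hXt.2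
    have hlow : (M i (X i t) : ℝ) + 1 ≤ s t := by exact_mod_cast hM_lt i t ht
    have hhigh : (s t : ℝ) ≤ M i (X i t + 1) := by exact_mod_cast hle_M i t ht
    have hoff : ((X i t : ℝ) - 1) / N < 1 := by rw [div_lt_one hN₀]; linarith
    have hoff' : 0 < (((X i t + 1 : ℕ) : ℝ) - 1) / N := by
      push_cast
      exact div_pos (by linarith) hN₀
    rw [hmin]
    exact ⟨div_lt_div_of_pos_right (by linarith) hS, div_lt_div_of_pos_right (by linarith) hS⟩

/-- **Theorem 2 (multiple alternatives).** Choice data over `N` ordered alternatives is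
rationalizable with multiple alternatives if and only if it has no cycles in the
multiple-alternative sense. -/
theorem multiple_alternatives_characterization {I : Type*} [Fintype I] [Nonempty I]
    (T N : ℕ) (hT : 1 ≤ T) (hN : 1 ≤ N) (X : I → ℕ → ℕ)
    (hX : ∀ i, ∀ t ∈ Finset.Icc 1 T, X i t ∈ Finset.Icc 1 N) :
    RationalizableMulti T N X ↔ ¬ HasCycleMulti T X := by
  exact ⟨not_hasCycleMulti_of_rationalizableMulti hX,
    rationalizableMulti_of_not_hasCycleMulti hN hX⟩
end

section
/- Let I be a nonempty finite set, T ≥ 1, N ≥ 1, and let X : I × {1,…,T} → {1,…,N} be choice data (recording the index of the chosen alternative) with no cycles in the multiple-alternative sense. Define a binary relation ≻ on I × {1,…,N+1} by: (i,n) ≻ (i,n−1) for every agent i and every n ∈ {2,…,N+1}; and, for distinct agents i ≠ j, (i,n) ≻ (j,n′) whenever n ∈ {2,…,N+1} and there exists a period t with X(i,t) = n−1 and X(j,t) = n′. Then ≻ is acyclic: its transitive closure is irreflexive, i.e., there is no finite sequence (i₁,n₁) ≻ (i₂,n₂) ≻ ⋯ ≻ (i_k,n_k) ≻ (i₁,n₁).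 -/
/-- The revealed relation `≻` on pairs `(i,n)` with `n ∈ {1,…,N+1}`:
`(i,n) ≻ (i,n−1)` for every agent `i` and `n ∈ {2,…,N+1}`; and for distinct agents
`i ≠ j`, `(i,n) ≻ (j,n′)` whenever `n ∈ {2,…,N+1}` and there is a period `t ∈ {1,…,T}`
with `X i t = n−1` and `X j t = n′`. -/
def SuccRel {I : Type*} (T N : ℕ) (X : I → ℕ → ℕ) : I × ℕ → I × ℕ → Prop :=
  fun a b =>
    (a.1 = b.1 ∧ 2 ≤ a.2 ∧ a.2 ≤ N + 1 ∧ b.2 = a.2 - 1) ∨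
    (a.1 ≠ b.1 ∧ 2 ≤ a.2 ∧ a.2 ≤ N + 1 ∧
      ∃ t ∈ Finset.Icc 1 T, X a.1 t = a.2 - 1 ∧ X b.1 t = b.2)

/-- The periods in `{1,…,T}` in which agent `a.1` chooses an alternative below `a.2`. -/
def periodsBelow {I : Type*} (T : ℕ) (X : I → ℕ → ℕ) (a : I × ℕ) : Finset ℕ :=
  (Finset.Icc 1 T).filter fun t => X a.1 t < a.2

/-- Without cycles, `≻` strictly decreases the pair `(periodsBelow T X a, a.2)`, ordered
lexicographically. -/
theorem SuccRel.toLex_lt {I : Type*} {T N : ℕ} {X : I → ℕ → ℕ} (hnc : ¬ HasCycleMulti T X)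
    {a b : I × ℕ} (h : SuccRel T N X a b) :
    toLex (periodsBelow T X b, b.2) < toLex (periodsBelow T X a, a.2) := by
  rw [Prod.Lex.toLex_lt_toLex']
  obtain ⟨i, n⟩ := a
  obtain ⟨j, m⟩ := b
  rcases h with ⟨hij, hn, -, hm⟩ | ⟨-, hn, -, t, ht, hit, hjt⟩
  · dsimp only at hij hn hm ⊢
    subst hij hm
    refine ⟨Finset.monotone_filter_right _ fun t _ h => ?_, fun _ => by omega⟩
    dsimp only at h ⊢
    omega
  · dsimp only at hn hit hjt ⊢
    refine ⟨fun s hs => ?_, fun h => ?_⟩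
    · simp only [periodsBelow, Finset.mem_filter] at hs ⊢
      refine ⟨hs.1, ?_⟩
      by_contra hle
      refine hnc ⟨s, hs.1, t, ht, ?_, i, j, by omega, by omega⟩
      rintro rfl
      omega
    · have hmem : t ∈ periodsBelow T X (i, n) :=
        Finset.mem_filter.mpr ⟨ht, by dsimp only; omega⟩
      rw [← h] at hmem
      have hlt : X j t < m := (Finset.mem_filter.mp hmem).2
      omega

/-- **Acyclicity of the revealed relation.** If the choice data has no cycles in the
multiple-alternative sense, then the relation `≻` is acyclic: its transitive closure is
irreflexive, i.e. there is no finite chain `(i₁,n₁) ≻ ⋯ ≻ (i_k,n_k) ≻ (i₁,n₁)`. -/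
theorem succRel_acyclic {I : Type*} [Fintype I] [Nonempty I]
    (T N : ℕ) (hT : 1 ≤ T) (hN : 1 ≤ N) (X : I → ℕ → ℕ)
    (hX : ∀ i, ∀ t ∈ Finset.Icc 1 T, X i t ∈ Finset.Icc 1 N)
    (hnc : ¬ HasCycleMulti T X) :
    ∀ a : I × ℕ, ¬ Relation.TransGen (SuccRel T N X) a a := by
  intro a h
  have hlt := Relation.TransGen.lift (p := (· > ·))
    (fun a : I × ℕ => toLex (periodsBelow T X a, a.2)) (fun _ _ h => SuccRel.toLex_lt hnc h) _ _ h
  rw [Relation.transGen_eq_self] at hlt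
  exact lt_irrefl _ hlt
end

section
/- Let I be a nonempty finite set of agents, T ≥ 1, X : I × {1,…,T} → {x,y} choice data, and fix any threshold profile ū : I → (0,1). Then the following are equivalent: (a) there exist private beliefs p : I × {1,…,T} → (0,1) such that for every agent i and period t, p_{i,t} > ū_i if X(i,t) = x and p_{i,t} < ū_i if X(i,t) = y, and for every period t < T the belief revisions are co-monotone across agents, i.e., either p_{i,t+1} ≤ p_{i,t} for all i ∈ I or p_{i,t+1} ≥ p_{i,t} for all i ∈ I; (b) X has no consecutive cycles. In particular, whenever X has no consecutive cycles, such beliefs exist for every threshold profile ū : I → (0,1). -/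
/-!
Choices are encoded by `Bool`: `true` stands for alternative `x`, `false` for `y`.
Periods are the natural numbers `1, …, T`.
-/

/-- `X` has a consecutive cycle: there are agents `i, j` and a period `t` with
`t + 1 ≤ T`, `X i t = x`, `X j t = y`, `X i (t+1) = y` and `X j (t+1) = x`. -/
def HasConsecutiveCycle {I : Type*} (T : ℕ) (X : I → ℕ → Bool) : Prop :=
  ∃ t, 1 ≤ t ∧ t + 1 ≤ T ∧ ∃ i j : I,
    X i t = true ∧ X j t = false ∧ X i (t+1) = false ∧ X j (t+1) = true

/-- **Theorem 3 (co-monotone experiments, time-invariant state), belief-level form.**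
Fix any threshold profile `u : I → (0,1)`. The following are equivalent:
(a) there are private beliefs `p : I × {1,…,T} → (0,1)` with `p i t > u i` if
`X i t = x` and `p i t < u i` if `X i t = y`, whose revisions are co-monotone across
agents at every period `t < T` (either all beliefs weakly decrease or all weakly
increase); (b) `X` has no consecutive cycles. -/
theorem comonotone_time_invariant_characterization {I : Type*} [Fintype I] [Nonempty I]
    (T : ℕ) (hT : 1 ≤ T) (X : I → ℕ → Bool)
    (u : I → ℝ) (hu : ∀ i, u i ∈ Set.Ioo (0:ℝ) 1) :
    (∃ p : I → ℕ → ℝ,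
      (∀ i, ∀ t ∈ Finset.Icc 1 T, p i t ∈ Set.Ioo (0:ℝ) 1) ∧
      (∀ i, ∀ t ∈ Finset.Icc 1 T,
        (X i t = true → u i < p i t) ∧ (X i t = false → p i t < u i)) ∧
      (∀ t, 1 ≤ t → t + 1 ≤ T →
        (∀ i, p i (t+1) ≤ p i t) ∨ (∀ i, p i t ≤ p i (t+1)))) ↔
    ¬ HasConsecutiveCycle T X := by
  constructor
  · rintro ⟨p, -, hp, hmono⟩ ⟨t, ht, htT, i, j, hi, hj, hi', hj'⟩
    have mem : t ∈ Finset.Icc 1 T := Finset.mem_Icc.2 ⟨ht, by omega⟩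
    have mem' : t + 1 ∈ Finset.Icc 1 T := Finset.mem_Icc.2 ⟨by omega, htT⟩
    have h1 := (hp i t mem).1 hi
    have h2 := (hp j t mem).2 hj
    have h3 := (hp i (t + 1) mem').2 hi'
    have h4 := (hp j (t + 1) mem').1 hj'
    rcases hmono t ht htT with h | h
    · linarith [h j]
    · linarith [h i]
  · intro hX
    refine ⟨fun i t => if X i t = true then (1 + u i) / 2 else u i / 2, ?_, ?_, ?_⟩
    · intro i t _
      obtain ⟨h0, h1⟩ := hu i
      dsimp only
      split_ifs <;> constructor <;> linarith
    · intro i t _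
      obtain ⟨h0, h1⟩ := hu i
      constructor <;> intro h <;> simp only [h] <;> norm_num <;> linarith
    · intro t ht htT
      by_cases hup : ∃ j, X j t = false ∧ X j (t + 1) = true
      · obtain ⟨j, hj, hj'⟩ := hup
        right
        intro i
        have hi : ¬ (X i t = true ∧ X i (t + 1) = false) := fun h =>
          hX ⟨t, ht, htT, i, j, h.1, hj, h.2, hj'⟩
        cases h : X i t <;> cases h' : X i (t + 1) <;> simp_all <;> linarith
      · left
        intro i
        have hi : ¬ (X i t = false ∧ X i (t + 1) = true) := fun h => hup ⟨i, h⟩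
        cases h : X i t <;> cases h' : X i (t + 1) <;> simp_all <;> linarith
end

section
/- Let I be a nonempty finite set of agents, T ≥ 1, X : I × {1,…,T} → {x,y} ANY choice data, and ū : I → (0,1) any threshold profile. Then there exist, for each period t, a common interim belief q_t with 0 < q_t < min_{i∈I} ū_i, and private posteriors p : I × {1,…,T} → (0,1) such that: (i) for every agent i and period t, p_{i,t} > ū_i if X(i,t) = x and p_{i,t} < ū_i if X(i,t) = y; and (ii) for every agent i and period t, p_{i,t} > q_t, so that within each period all agents' posteriors move in the same direction relative to the common interim belief (i.e., (p_{i,t} − q_t)(p_{j,t} − q_t) > 0 for all i, j). Hence, with a time-varying state, every choice data set is rationalizable with strictly co-monotone experiments. -/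
/-!
Choices are encoded by `Bool`: `true` stands for alternative `x`, `false` for `y`.
Periods are the natural numbers `1, …, T`.
-/

/-- **Theorem 4 (time-varying state: anything goes), belief-level form.** For ANY choice
data `X` and any threshold profile `u : I → (0,1)`, there exist common interim beliefs
`q t` with `0 < q t < min_i u i` and private posteriors `p : I × {1,…,T} → (0,1)` such
that (i) `p i t > u i` if `X i t = x` and `p i t < u i` if `X i t = y`, and (ii)
`p i t > q t` for every agent `i`, so that `(p i t − q t) * (p j t − q t) > 0` for all
pairs of agents. Hence, with a time-varying state, every choice data set is
rationalizable with strictly co-monotone experiments. -/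
theorem time_varying_anything_goes {I : Type*} [Fintype I] [Nonempty I]
    (T : ℕ) (hT : 1 ≤ T) (X : I → ℕ → Bool)
    (u : I → ℝ) (hu : ∀ i, u i ∈ Set.Ioo (0:ℝ) 1) :
    ∃ (q : ℕ → ℝ) (p : I → ℕ → ℝ),
      (∀ t ∈ Finset.Icc 1 T, 0 < q t ∧ ∀ i, q t < u i) ∧
      (∀ i, ∀ t ∈ Finset.Icc 1 T, p i t ∈ Set.Ioo (0:ℝ) 1) ∧
      (∀ i, ∀ t ∈ Finset.Icc 1 T,
        (X i t = true → u i < p i t) ∧ (X i t = false → p i t < u i)) ∧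
      (∀ i, ∀ t ∈ Finset.Icc 1 T, q t < p i t) ∧
      (∀ t ∈ Finset.Icc 1 T, ∀ i j : I, 0 < (p i t - q t) * (p j t - q t)) := by
  obtain ⟨m, hm⟩ := Finite.exists_min u
  have hm0 : 0 < u m := (hu m).1
  have hq (i : I) : u m / 2 < u i := by linarith [hm i]
  let p : I → ℕ → ℝ := fun i t => if X i t then (u i + 1) / 2 else (u m / 2 + u i) / 2
  have hp (i : I) (t : ℕ) : u m / 2 < p i t ∧ p i t < 1 ∧
      (X i t = true → u i < p i t) ∧ (X i t = false → p i t < u i) := by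
    have h1 := (hu i).2
    have h2 := hq i
    cases h : X i t <;> simp only [p, h] <;> norm_num <;> constructor <;> grind
  refine ⟨fun _ => u m / 2, p, fun _ _ => ⟨half_pos hm0, hq⟩,
    fun i t _ => ⟨(half_pos hm0).trans (hp i t).1, (hp i t).2.1⟩,
    fun i t _ => (hp i t).2.2, fun i t _ => (hp i t).1, fun t _ i j => ?_⟩
  exact mul_pos (sub_pos.mpr (hp i t).1) (sub_pos.mpr (hp j t).1)
end

section
/- Let I be a nonempty finite index set and suppose there exist positive real numbers (π_i^x, π_i^y)_{i∈I} with ∑_{i∈I} π_i^x < 1, ∑_{i∈I} π_i^y < 1, and (π_i^x − π_i^y)·(π_j^x − π_j^y) > 0 for all i, j ∈ I. Then, taking each agent's signal set to be S = Option I (the set {s⁰} ∪ {sⁱ : i ∈ I}), there exist probability distributions P^x and P^y on the finite set of signal profiles I → S and a profile s* ∈ (I → S) (namely s*(i) = sⁱ) such that: (i) s* lies in the support of both P^x and P^y; (ii) for every agent i, the i-th marginal satisfies marg_i P^x(s*(i)) = π_i^x and marg_i P^y(s*(i)) = π_i^y; and (iii) the experiment is strictly co-monotone: for every profile s in the support of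 P^x or of P^y and all agents i, j, (marg_i P^x(s(i)) − marg_i P^y(s(i)))·(marg_j P^x(s(j)) − marg_j P^y(s(j))) > 0. -/
/-!
Each agent's signal set is `Option I`: `none` plays the role of the signal `s⁰`, and
`some i` plays the role of the signal `sⁱ`. An experiment in a given state is a
probability distribution on signal profiles `I → Option I`.
-/

/-- The `i`-th marginal of a distribution `P` on signal profiles, evaluated at signal
`s`: the total probability of profiles `g` with `g i = s`. -/
def marg {I : Type*} [Fintype I] [DecidableEq I]
    (P : (I → Option I) → ℝ) (i : I) (s : Option I) : ℝ :=
  ∑ g : I → Option I, if g i = s then P g else 0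

/-- The weight of the constant profile `fun _ => o`: `π i - ε` for `o = some i`, and the
remaining mass for `o = none`. -/
def constWeight {I : Type*} [Fintype I] (π : I → ℝ) (ε : ℝ) : Option I → ℝ
  | none => 1 - ε - ∑ i, (π i - ε)
  | some i => π i - ε

/-- The distribution giving mass `ε` to the profile `some` and the remaining mass to the
constant profiles, according to `constWeight`. -/
def joint {I : Type*} [Fintype I] [DecidableEq I] (π : I → ℝ) (ε : ℝ)
    (g : I → Option I) : ℝ :=
  (if g = (fun i => some i) then ε else 0) +
    ∑ o : Option I, if g = (fun _ => o) then constWeight π ε o else 0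

section

variable {I : Type*} [Fintype I] {π : I → ℝ} {ε : ℝ}

lemma constWeight_nonneg [Nonempty I] (hε : 0 ≤ ε) (hπ : ∀ i, ε ≤ π i)
    (hsum : ∑ i, π i < 1) (o : Option I) : 0 ≤ constWeight π ε o := by
  cases o with
  | some i => simpa [constWeight] using hπ i
  | none =>
    have hcard : (1 : ℝ) ≤ Fintype.card I := by exact_mod_cast Fintype.card_pos
    simp only [constWeight, Finset.sum_sub_distrib, Finset.sum_const, Finset.card_univ,
      nsmul_eq_mul]
    nlinarith

variable [DecidableEq I]

lemma joint_nonneg (hε : 0 ≤ ε) (hw : ∀ o, 0 ≤ constWeight π ε o) (g : I → Option I) :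
    0 ≤ joint π ε g := by
  refine add_nonneg ?_ (Finset.sum_nonneg fun o _ => ?_)
  · split_ifs <;> simp [hε]
  · split_ifs <;> simp [hw]

lemma sum_joint : ∑ g : I → Option I, joint π ε g = 1 := by
  simp only [joint, Finset.sum_add_distrib]
  rw [Finset.sum_comm]
  simp [Fintype.sum_option, constWeight]

lemma joint_some_pos (hε : 0 < ε) (hw : ∀ o, 0 ≤ constWeight π ε o) :
    0 < joint π ε (fun i => some i) := by
  refine add_pos_of_pos_of_nonneg (by simpa using hε) (Finset.sum_nonneg fun o _ => ?_)
  split_ifs <;> simp [hw]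

lemma eq_some_or_const_of_joint_pos {g : I → Option I} (h : 0 < joint π ε g) :
    g = (fun i => some i) ∨ ∃ o, g = fun _ => o := by
  by_contra! hg
  simp [joint, hg.1, hg.2] at h

lemma marg_joint (i : I) (s : Option I) :
    marg (joint π ε) i s = (if some i = s then ε else 0) + constWeight π ε s := by
  have key (a : I → Option I) (c : ℝ) :
      (∑ g : I → Option I, if g i = s then (if g = a then c else 0) else 0) =
        if a i = s then c else 0 := by
    rw [Finset.sum_eq_single a (fun g _ hg => by simp [hg]) (by simp)]
    simp
  have split (g : I → Option I) :
      (if g i = s then joint π ε g else 0) =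
        (if g i = s then (if g = (fun i => some i) then ε else 0) else 0) +
        ∑ o : Option I,
          if g i = s then (if g = (fun _ => o) then constWeight π ε o else 0) else 0 := by
    by_cases h : g i = s
    · simp only [if_pos h, joint]
    · simp only [if_neg h, Finset.sum_const_zero, add_zero]
  simp only [marg, split, Finset.sum_add_distrib]
  rw [Finset.sum_comm]
  simp only [key]
  simp

end

/-- **Lemma A.1 (from marginals to joint distributions).** Given positive numbers
`(πx i, πy i)` with `∑ πx < 1`, `∑ πy < 1` and `(πx i − πy i) * (πx j − πy j) > 0` for
all `i, j`, there exist probability distributions `Px, Py` on signal profiles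
`I → Option I` such that the profile `s* = fun i => some i` is in the support of both,
the `i`-th marginals at `s* i = some i` equal `πx i` and `πy i` respectively, and the
experiment is strictly co-monotone: for every profile `g` in the support of `Px` or
`Py`, the marginal differences have the same strict sign across agents. -/
theorem marginals_to_joint {I : Type*} [Fintype I] [DecidableEq I] [Nonempty I]
    (πx πy : I → ℝ)
    (hx : ∀ i, 0 < πx i) (hy : ∀ i, 0 < πy i)
    (hsx : ∑ i, πx i < 1) (hsy : ∑ i, πy i < 1)
    (hcm : ∀ i j, 0 < (πx i - πy i) * (πx j - πy j)) :
    ∃ Px Py : (I → Option I) → ℝ,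
      (∀ g, 0 ≤ Px g) ∧ (∀ g, 0 ≤ Py g) ∧
      (∑ g : I → Option I, Px g = 1) ∧ (∑ g : I → Option I, Py g = 1) ∧
      0 < Px (fun i => some i) ∧ 0 < Py (fun i => some i) ∧
      (∀ i, marg Px i (some i) = πx i ∧ marg Py i (some i) = πy i) ∧
      (∀ g : I → Option I, (0 < Px g ∨ 0 < Py g) → ∀ i j,
        0 < (marg Px i (g i) - marg Py i (g i)) *
            (marg Px j (g j) - marg Py j (g j))) := by
  obtain ⟨ε, hε, hεx, hεy⟩ : ∃ ε : ℝ, 0 < ε ∧ (∀ i, ε ≤ πx i) ∧ ∀ i, ε ≤ πy i := by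
    obtain ⟨a, ha⟩ := Finite.exists_min πx
    obtain ⟨b, hb⟩ := Finite.exists_min πy
    exact ⟨min (πx a) (πy b), lt_min (hx a) (hy b), fun i => (min_le_left _ _).trans (ha i),
      fun i => (min_le_right _ _).trans (hb i)⟩
  have hwx := constWeight_nonneg hε.le hεx hsx
  have hwy := constWeight_nonneg hε.le hεy hsy
  have hdiff (i : I) (s : Option I) :
      marg (joint πx ε) i s - marg (joint πy ε) i s =
        constWeight πx ε s - constWeight πy ε s := by
    rw [marg_joint, marg_joint]
    ring
  have hsome (i : I) :
      constWeight πx ε (some i) - constWeight πy ε (some i) = πx i - πy i := by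
    simp [constWeight]
  have hnone : constWeight πx ε none - constWeight πy ε none = -∑ i, (πx i - πy i) := by
    simp only [constWeight, Finset.sum_sub_distrib]
    ring
  have hsq : 0 < (∑ i, (πx i - πy i)) * ∑ i, (πx i - πy i) := by
    rw [Finset.sum_mul_sum]
    exact Finset.sum_pos (fun i _ => Finset.sum_pos (fun j _ => hcm i j)
      Finset.univ_nonempty) Finset.univ_nonempty
  refine ⟨joint πx ε, joint πy ε, joint_nonneg hε.le hwx, joint_nonneg hε.le hwy, sum_joint,
    sum_joint, joint_some_pos hε hwx, joint_some_pos hε hwy,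
    fun i => ⟨by simp [marg_joint, constWeight], by simp [marg_joint, constWeight]⟩, ?_⟩
  intro g hg i j
  rw [hdiff, hdiff]
  rcases hg.elim eq_some_or_const_of_joint_pos eq_some_or_const_of_joint_pos with
    rfl | ⟨_ | k, rfl⟩
  · simpa only [hsome] using hcm i j
  · simpa only [hnone, neg_mul_neg] using hsq
  · simpa only [hsome] using hcm k k
end

section
/- Let q ∈ (0,1) be a prior belief, a, b > 0 signal likelihoods, and β ≥ 0 a distortion parameter. Define the distorted (Grether) posterior p = q·a^β / (q·a^β + (1−q)·b^β). Then p > q implies a > b, and p < q implies a < b. Consequently, if two agents i, j both update by this rule (with possibly different parameters β_i, β_j ≥ 0) from priors q_i, q_j ∈ (0,1) using likelihood pairs satisfying (a_i − b_i)(a_j − b_j) ≥ 0, then p_i > q_i implies p_j ≥ q_j and p_i < q_i implies p_j ≤ q_j. -/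
/-!
`a ^ β` denotes the real power `Real.rpow` for positive base `a` and exponent `β ≥ 0`.
-/

/-- The Grether posterior is at most the prior when the signal weakly favours the other state. -/
theorem grether_posterior_le_prior {q a b β : ℝ} (hq : q ∈ Set.Ioo (0 : ℝ) 1)
    (ha : 0 < a) (hβ : 0 ≤ β) (hab : a ≤ b) :
    q * a ^ β / (q * a ^ β + (1 - q) * b ^ β) ≤ q := by
  have hA : 0 < a ^ β := Real.rpow_pos_of_pos ha β
  have hAB : a ^ β ≤ b ^ β := Real.rpow_le_rpow ha.le hab hβ
  have hq0 : 0 < q := hq.1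
  have hq1 : 0 < 1 - q := sub_pos.2 hq.2
  have hB : 0 < b ^ β := hA.trans_le hAB
  rw [div_le_iff₀ (by positivity)]
  nlinarith [mul_nonneg (mul_pos hq0 hq1).le (sub_nonneg.2 hAB)]

/-- The Grether posterior is at least the prior when the signal weakly favours the state. -/
theorem prior_le_grether_posterior {q a b β : ℝ} (hq : q ∈ Set.Ioo (0 : ℝ) 1)
    (hb : 0 < b) (hβ : 0 ≤ β) (hba : b ≤ a) :
    q ≤ q * a ^ β / (q * a ^ β + (1 - q) * b ^ β) := by
  have hB : 0 < b ^ β := Real.rpow_pos_of_pos hb β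
  have hBA : b ^ β ≤ a ^ β := Real.rpow_le_rpow hb.le hba hβ
  have hq0 : 0 < q := hq.1
  have hq1 : 0 < 1 - q := sub_pos.2 hq.2
  have hA : 0 < a ^ β := hB.trans_le hBA
  rw [le_div_iff₀ (by positivity)]
  nlinarith [mul_nonneg (mul_pos hq0 hq1).le (sub_nonneg.2 hBA)]

/-- **Grether (distorted) updating is co-monotone.** With prior `q ∈ (0,1)`,
likelihoods `a, b > 0` and distortion `β ≥ 0`, the Grether posterior
`p = q * a^β / (q * a^β + (1−q) * b^β)` satisfies: `p > q` implies `a > b`, and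
`p < q` implies `a < b`. Consequently, if two agents `i, j` update by this rule (with
possibly different parameters `βi, βj ≥ 0`) from priors `qi, qj ∈ (0,1)` using
likelihood pairs with `(ai − bi) * (aj − bj) ≥ 0`, then `pi > qi` implies `pj ≥ qj`
and `pi < qi` implies `pj ≤ qj`. -/
theorem grether_comonotone
    (qi qj ai bi aj bj βi βj : ℝ)
    (hqi : qi ∈ Set.Ioo (0:ℝ) 1) (hqj : qj ∈ Set.Ioo (0:ℝ) 1)
    (hai : 0 < ai) (hbi : 0 < bi) (haj : 0 < aj) (hbj : 0 < bj)
    (hβi : 0 ≤ βi) (hβj : 0 ≤ βj)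
    (hcm : 0 ≤ (ai - bi) * (aj - bj)) :
    (∀ q a b β : ℝ, q ∈ Set.Ioo (0:ℝ) 1 → 0 < a → 0 < b → 0 ≤ β →
      (q < q * a ^ β / (q * a ^ β + (1 - q) * b ^ β) → b < a) ∧
      (q * a ^ β / (q * a ^ β + (1 - q) * b ^ β) < q → a < b)) ∧
    (qi < qi * ai ^ βi / (qi * ai ^ βi + (1 - qi) * bi ^ βi) →
      qj ≤ qj * aj ^ βj / (qj * aj ^ βj + (1 - qj) * bj ^ βj)) ∧
    (qi * ai ^ βi / (qi * ai ^ βi + (1 - qi) * bi ^ βi) < qi →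
      qj * aj ^ βj / (qj * aj ^ βj + (1 - qj) * bj ^ βj) ≤ qj) := by
  refine ⟨fun q a b β hq ha hb hβ => ⟨fun h => ?_, fun h => ?_⟩, fun h => ?_, fun h => ?_⟩
  · exact lt_of_not_ge fun hab => h.not_ge (grether_posterior_le_prior hq ha hβ hab)
  · exact lt_of_not_ge fun hba => h.not_ge (prior_le_grether_posterior hq hb hβ hba)
  · have hi : bi < ai :=
      lt_of_not_ge fun hab => h.not_ge (grether_posterior_le_prior hqi hai hβi hab)
    have hj : 0 ≤ aj - bj := nonneg_of_mul_nonneg_right hcm (sub_pos.2 hi)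
    exact prior_le_grether_posterior hqj hbj hβj (sub_nonneg.1 hj)
  · have hi : ai < bi :=
      lt_of_not_ge fun hba => h.not_ge (prior_le_grether_posterior hqi hbi hβi hba)
    have hj : aj ≤ bj := by
      by_contra! hj
      exact hcm.not_gt (mul_neg_of_neg_of_pos (sub_neg.2 hi) (sub_pos.2 hj))
    exact grether_posterior_le_prior hqj haj hβj hj
end

section
/- Let I be a nonempty finite set, T ≥ 1, N ≥ 1, and let X : I × {1,…,T} → {1,…,N} be choice data. Suppose there exist, for each agent i, cutoffs ū_{i,1} < ū_{i,2} < ⋯ < ū_{i,N+1} (strictly increasing in the index) and real numbers p : {1,…,T} → ℝ such that ū_{i,X(i,t)} < p_t < ū_{i,X(i,t)+1} for every agent i and period t. Then X has no cycles in the multiple-alternative sense: there are no distinct periods t₁ ≠ t₂ and agents i, j with X(i,t₁) > X(i,t₂) and X(j,t₁) < X(j,t₂). -/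
/-- A sequence increasing at each step from `1` to `N + 1` is monotone there. -/
lemma le_of_forall_lt_succ_of_mem_Icc {α : Type*} [Preorder α] {f : ℕ → α} {N m n : ℕ}
    (hf : ∀ k ∈ Finset.Icc 1 N, f k < f (k + 1)) (hm : 1 ≤ m) (hmn : m ≤ n)
    (hn : n ≤ N + 1) : f m ≤ f n := by
  induction n, hmn using Nat.le_induction with
  | base => exact le_rfl
  | succ k hk ih =>
    exact (ih (by omega)).trans (hf k (Finset.mem_Icc.2 ⟨by omega, by omega⟩)).le

/-- Along interval choices with increasing cutoffs, a higher choice reveals a higher belief. -/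
lemma belief_lt_of_choice_lt {α : Type*} [Preorder α] {u : ℕ → α} {N m n : ℕ} {p q : α}
    (hu : ∀ k ∈ Finset.Icc 1 N, u k < u (k + 1)) (hn : n ≤ N)
    (hmn : m < n) (hp : p < u (m + 1)) (hq : u n < q) : p < q :=
  (hp.trans_le (le_of_forall_lt_succ_of_mem_Icc hu (by omega) hmn (by omega))).trans hq

/-- **Necessity with multiple alternatives.** If for each agent `i` the cutoffs
`u i 1 < u i 2 < ⋯ < u i (N+1)` are strictly increasing in the index and there are
common beliefs `p : {1,…,T} → ℝ` (formed in any way whatsoever) with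
`u i (X i t) < p t < u i (X i t + 1)` for every agent `i` and period `t`, then `X` has
no cycles in the multiple-alternative sense. -/
theorem multi_alternatives_necessity {I : Type*} [Fintype I] [Nonempty I]
    (T N : ℕ) (hT : 1 ≤ T) (hN : 1 ≤ N) (X : I → ℕ → ℕ)
    (hX : ∀ i, ∀ t ∈ Finset.Icc 1 T, X i t ∈ Finset.Icc 1 N)
    (u : I → ℕ → ℝ)
    (hu : ∀ i, ∀ n ∈ Finset.Icc 1 N, u i n < u i (n+1))
    (p : ℕ → ℝ)
    (hopt : ∀ i, ∀ t ∈ Finset.Icc 1 T,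
      u i (X i t) < p t ∧ p t < u i (X i t + 1)) :
    ¬ HasCycleMulti T X := by
  rintro ⟨t₁, ht₁, t₂, ht₂, -, i, j, hi, hj⟩
  exact lt_asymm
    (belief_lt_of_choice_lt (hu i) (Finset.mem_Icc.1 (hX i t₁ ht₁)).2 hi
      (hopt i t₂ ht₂).2 (hopt i t₁ ht₁).1)
    (belief_lt_of_choice_lt (hu j) (Finset.mem_Icc.1 (hX j t₂ ht₂)).2 hj
      (hopt j t₁ ht₁).2 (hopt j t₂ ht₂).1)
end
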